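/- arXiv:1811.12038 — 3 statements merged into one kernel-verified Lean document; each statement's English description precedes it below -/
import Mathlib

section
/- Let m be a natural number and let W ⊆ ℝ^m be an ℝ-linear subspace whose dimension is even. Then there exists a ℂ-linear subspace 𝔥 of ℂ^m such that the real-part map Re restricted to 𝔥 is injective and Re(𝔥) = W. -/
/-- The componentwise real-part map `ℂ^m → ℝ^m`, as an `ℝ`-linear map. -/
noncomputable def ReMap (m : ℕ) : (Fin m → ℂ) →ₗ[ℝ] (Fin m → ℝ) :=
  LinearMap.pi fun i => Complex.reLm.comp (LinearMap.proj i)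

/-- An `ℝ`-linear map `f` from a complex vector space to `ℝ^m` is the real part of the `ℂ`-linear
map `v ↦ f v - i f (i v)`. -/
theorem exists_complex_linear_reMap_eq {V : Type*} [AddCommGroup V] [Module ℂ V] [Module ℝ V]
    [IsScalarTower ℝ ℂ V] {m : ℕ} (f : V →ₗ[ℝ] (Fin m → ℝ)) :
    ∃ g : V →ₗ[ℂ] (Fin m → ℂ), ∀ v, ReMap m (g v) = f v := by
  have smul_eq (c : ℂ) (v : V) : c • v = c.re • v + c.im • (Complex.I • v) := by
    rw [← smul_assoc, ← algebraMap_smul ℂ c.re v, ← add_smul]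
    congr 1
    apply Complex.ext <;> simp
  refine ⟨{ toFun := fun v i => ⟨f v i, -f (Complex.I • v) i⟩
            map_add' := fun v w => ?_
            map_smul' := fun c v => ?_ }, fun v => ?_⟩
  · ext i
    apply Complex.ext <;> simp [add_comm]
  · have h : Complex.I • c • v = c.re • (Complex.I • v) - c.im • v := by
      rw [← mul_smul, smul_eq (Complex.I * c) v]
      simp [sub_eq_add_neg, add_comm]
    ext i
    apply Complex.ext
    · simp [smul_eq c v]
    · simp only [h]
      simp
      ring
  · ext i
    simp [ReMap]

/-- For every even-dimensional `ℝ`-subspace `W ⊆ ℝ^m` there is a `ℂ`-subspace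
`𝔥 ⊆ ℂ^m` on which the real-part map is injective with `Re(𝔥) = W`. -/
theorem stmt3 (m : ℕ) (W : Submodule ℝ (Fin m → ℝ)) (hW : Even (Module.finrank ℝ W)) :
    ∃ 𝔥 : Submodule ℂ (Fin m → ℂ),
      Set.InjOn (ReMap m) (𝔥 : Set (Fin m → ℂ)) ∧
      ReMap m '' (𝔥 : Set (Fin m → ℂ)) = (W : Set (Fin m → ℝ)) := by
  obtain ⟨k, hk⟩ := hW
  have hfin : Module.finrank ℝ (Fin k → ℂ) = Module.finrank ℝ W := by
    rw [Module.finrank_pi_fintype, hk]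
    simp [Complex.finrank_real_complex, mul_two]
  let e : (Fin k → ℂ) ≃ₗ[ℝ] W := LinearEquiv.ofFinrankEq _ _ hfin
  obtain ⟨g, hg⟩ := exists_complex_linear_reMap_eq (W.subtype ∘ₗ e.toLinearMap)
  refine ⟨LinearMap.range g, ?_, ?_⟩
  · rintro _ ⟨v, rfl⟩ _ ⟨w, rfl⟩ h
    rw [hg, hg] at h
    rw [e.injective (Subtype.ext h)]
  · ext x
    constructor
    · rintro ⟨_, ⟨v, rfl⟩, rfl⟩
      rw [hg]
      exact (e v).2
    · intro hx
      refine ⟨g (e.symm ⟨x, hx⟩), ⟨_, rfl⟩, ?_⟩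
      simp [hg]
end

section
/- Under the fiber-product setup, the intersection of the ℝ-linear span 𝔤₀ of Γ₀ with the subgroup Γ₁ × Γ₂ of V₁ × V₂ equals Γ₀. -/
/-- Fiber-product setup: the intersection of the `ℝ`-linear span `𝔤₀` of
`Γ₀ = {(γ₁, γ₂) ∈ Γ₁ × Γ₂ : φ(q₁ γ₁) = q₂ γ₂}` with `Γ₁ × Γ₂` equals `Γ₀`. -/
theorem stmt5 (V₁ V₂ : Type*) [AddCommGroup V₁] [Module ℝ V₁]
    [AddCommGroup V₂] [Module ℝ V₂]
    (W₁ : Submodule ℝ V₁) (W₂ : Submodule ℝ V₂)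
    (φ : (V₁ ⧸ W₁) ≃ₗ[ℝ] (V₂ ⧸ W₂))
    (Γ₁ : AddSubgroup V₁) (Γ₂ : AddSubgroup V₂)
    (hΓ : ⇑φ '' (⇑W₁.mkQ '' (Γ₁ : Set V₁)) = ⇑W₂.mkQ '' (Γ₂ : Set V₂))
    (Γ₀ : Set (V₁ × V₂))
    (hΓ₀ : Γ₀ = {p | p.1 ∈ Γ₁ ∧ p.2 ∈ Γ₂ ∧ φ (W₁.mkQ p.1) = W₂.mkQ p.2}) :
    (Submodule.span ℝ Γ₀ : Set (V₁ × V₂)) ∩ (Γ₁.prod Γ₂ : Set (V₁ × V₂)) = Γ₀ := by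
  subst hΓ₀
  refine Set.Subset.antisymm ?_ fun p hp => ⟨Submodule.subset_span hp, hp.1, hp.2.1⟩
  rintro p ⟨hspan, h₁, h₂⟩
  refine ⟨h₁, h₂, ?_⟩
  have hle : Submodule.span ℝ {p : V₁ × V₂ | p.1 ∈ Γ₁ ∧ p.2 ∈ Γ₂ ∧
      φ (W₁.mkQ p.1) = W₂.mkQ p.2} ≤
      LinearMap.eqLocus (φ.toLinearMap ∘ₗ W₁.mkQ ∘ₗ LinearMap.fst ℝ V₁ V₂)
        (W₂.mkQ ∘ₗ LinearMap.snd ℝ V₁ V₂) :=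
    Submodule.span_le.2 fun _ hp => hp.2.2
  exact hle hspan
end

section
/- Under the fiber-product setup, assume in addition that Γ₁ spans V₁ over ℝ. Then the ℝ-linear map 𝔤₀ → V₁/W₁ sending (x₁, x₂) to q₁(x₁) is surjective and its kernel equals 𝔤₀ ∩ (W₁ × W₂); consequently it induces an ℝ-linear isomorphism 𝔤₀ / (𝔤₀ ∩ (W₁ × W₂)) ≅ V₁/W₁. -/
/-- Fiber-product setup: if `Γ₁` spans `V₁` over `ℝ`, the `ℝ`-linear map
`𝔤₀ → V₁/W₁`, `(x₁, x₂) ↦ q₁(x₁)`, is surjective, its kernel equals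
`𝔤₀ ∩ (W₁ × W₂)`, and it induces an isomorphism
`𝔤₀ / (𝔤₀ ∩ (W₁ × W₂)) ≅ V₁/W₁`. -/
theorem stmt8 (V₁ V₂ : Type*) [AddCommGroup V₁] [Module ℝ V₁]
    [AddCommGroup V₂] [Module ℝ V₂]
    (W₁ : Submodule ℝ V₁) (W₂ : Submodule ℝ V₂)
    (φ : (V₁ ⧸ W₁) ≃ₗ[ℝ] (V₂ ⧸ W₂))
    (Γ₁ : AddSubgroup V₁) (Γ₂ : AddSubgroup V₂)
    (hΓ : ⇑φ '' (⇑W₁.mkQ '' (Γ₁ : Set V₁)) = ⇑W₂.mkQ '' (Γ₂ : Set V₂))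
    (hspan : Submodule.span ℝ (Γ₁ : Set V₁) = ⊤)
    (Γ₀ : Set (V₁ × V₂))
    (hΓ₀ : Γ₀ = {p | p.1 ∈ Γ₁ ∧ p.2 ∈ Γ₂ ∧ φ (W₁.mkQ p.1) = W₂.mkQ p.2})
    (𝔤₀ : Submodule ℝ (V₁ × V₂)) (h𝔤₀ : 𝔤₀ = Submodule.span ℝ Γ₀)
    (f : 𝔤₀ →ₗ[ℝ] V₁ ⧸ W₁)
    (hf : f = W₁.mkQ ∘ₗ (LinearMap.fst ℝ V₁ V₂) ∘ₗ 𝔤₀.subtype) :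
    Function.Surjective f ∧
    LinearMap.ker f = (W₁.prod W₂).comap 𝔤₀.subtype ∧
    ∃ e : (𝔤₀ ⧸ (W₁.prod W₂).comap 𝔤₀.subtype) ≃ₗ[ℝ] V₁ ⧸ W₁,
      ∀ x : 𝔤₀, e (Submodule.Quotient.mk x) = f x := by
  have h_fst : 𝔤₀.map (LinearMap.fst ℝ V₁ V₂) = ⊤ := by
    rw [eq_top_iff, ← hspan, h𝔤₀, Submodule.map_span]
    refine Submodule.span_mono fun a ha => ?_
    obtain ⟨b, hb, hab⟩ : φ (W₁.mkQ a) ∈ ⇑W₂.mkQ '' (Γ₂ : Set V₂) :=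
      hΓ ▸ ⟨_, ⟨a, ha, rfl⟩, rfl⟩
    exact ⟨(a, b), by rw [hΓ₀]; exact ⟨ha, hb, hab.symm⟩, rfl⟩
  have h_graph : ∀ p ∈ 𝔤₀, φ (W₁.mkQ p.1) = W₂.mkQ p.2 := by
    have h_le : 𝔤₀ ≤ LinearMap.eqLocus
        (φ.toLinearMap ∘ₗ W₁.mkQ ∘ₗ LinearMap.fst ℝ V₁ V₂)
        (W₂.mkQ ∘ₗ LinearMap.snd ℝ V₁ V₂) := by
      rw [h𝔤₀, Submodule.span_le, hΓ₀]
      exact fun p hp => hp.2.2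
    exact fun p hp => h_le hp
  have h_apply : ∀ x : 𝔤₀, f x = W₁.mkQ (x : V₁ × V₂).1 := fun x => by rw [hf]; rfl
  have h_surj : Function.Surjective f := by
    intro y
    obtain ⟨a, rfl⟩ := W₁.mkQ_surjective y
    obtain ⟨p, hp, rfl⟩ : a ∈ 𝔤₀.map (LinearMap.fst ℝ V₁ V₂) := h_fst ▸ Submodule.mem_top
    exact ⟨⟨p, hp⟩, h_apply _⟩
  have h_ker : LinearMap.ker f = (W₁.prod W₂).comap 𝔤₀.subtype := by
    ext x
    have hx := h_graph x x.2
    rw [LinearMap.mem_ker, h_apply, Submodule.mem_comap, Submodule.mem_prod,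
      Submodule.subtype_apply, ← Submodule.Quotient.mk_eq_zero W₁,
      ← Submodule.Quotient.mk_eq_zero W₂, ← Submodule.mkQ_apply, ← Submodule.mkQ_apply, ← hx]
    exact ⟨fun h => ⟨h, by rw [h, map_zero]⟩, And.left⟩
  exact ⟨h_surj, h_ker, (Submodule.quotEquivOfEq _ _ h_ker.symm).trans
    (f.quotKerEquivOfSurjective h_surj), fun _ => rfl⟩
end
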